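/- Every local derivation of the algebra S₂ is a derivation. -/

import Mathlib

set_option maxSynthPendingDepth 3

/-- The 2-dimensional vector space `V₂ = F²`, with standard basis `v₁ = (1,0)`, `v₂ = (0,1)`. -/
abbrev V2 (F : Type*) [Field F] := Fin 2 → F

/-- The fixed vector `v₁` (the first standard basis vector of `V₂`). -/
noncomputable def v1 (F : Type*) [Field F] : V2 F := Pi.single 0 1

/-- `W(2)`: the space of all bilinear multiplications on `V₂`. -/
abbrev Wtwo (F : Type*) [Field F] := V2 F →ₗ[F] V2 F →ₗ[F] V2 F

variable {F : Type*} [Field F]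

/-- The Kantor product on `W(2)`:
`(A·B)(x,y) = A(v₁, B(x,y)) − B(A(v₁,x), y) − B(x, A(v₁,y))`. -/
noncomputable def wmul (A B : Wtwo F) : Wtwo F :=
  LinearMap.mk₂ F
    (fun x y => A (v1 F) (B x y) - B (A (v1 F) x) y - B x (A (v1 F) y))
    (fun x x' y => by simp only [map_add, LinearMap.add_apply]; abel)
    (fun c x y => by simp only [map_smul, LinearMap.smul_apply, smul_sub])
    (fun x y y' => by simp only [map_add, LinearMap.add_apply]; abel)
    (fun c x y => by simp only [map_smul, LinearMap.smul_apply, smul_sub])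

/-- The multiplication `α^k_{i,j}` determined by `α^k_{i,j}(v_t, v_l) = δ_{it} δ_{jl} v_k`
(indices `0, 1` correspond to `1, 2` in the paper). -/
noncomputable def alph (k i j : Fin 2) : Wtwo F :=
  LinearMap.mk₂ F
    (fun x y => (x i * y j) • (Pi.single k 1 : V2 F))
    (fun x x' y => by simp [add_mul, add_smul])
    (fun c x y => by simp [smul_smul, mul_assoc])
    (fun x y y' => by simp [mul_add, add_smul])
    (fun c x y => by simp [smul_smul]; ring_nf)

noncomputable def e1 (F : Type*) [Field F] : Wtwo F := alph 0 0 0 - alph 1 0 1 - alph 1 1 0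

noncomputable def e2 (F : Type*) [Field F] : Wtwo F := alph 1 0 0

noncomputable def e3 (F : Type*) [Field F] : Wtwo F := alph 1 1 1 - alph 0 0 1 - alph 0 1 0

noncomputable def e4 (F : Type*) [Field F] : Wtwo F := alph 0 1 1


theorem wmul_add_left (A A' B : Wtwo F) : wmul (A + A') B = wmul A B + wmul A' B := by
  apply LinearMap.ext; intro x; apply LinearMap.ext; intro y
  simp [wmul]; abel

theorem wmul_smul_left (c : F) (A B : Wtwo F) : wmul (c • A) B = c • wmul A B := by
  apply LinearMap.ext; intro x; apply LinearMap.ext; intro y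
  simp [wmul, smul_sub]

theorem wmul_add_right (A B B' : Wtwo F) : wmul A (B + B') = wmul A B + wmul A B' := by
  apply LinearMap.ext; intro x; apply LinearMap.ext; intro y
  simp [wmul]; abel

theorem wmul_smul_right (c : F) (A B : Wtwo F) : wmul A (c • B) = c • wmul A B := by
  apply LinearMap.ext; intro x; apply LinearMap.ext; intro y
  simp [wmul, smul_sub]

theorem wmul_sub_left (A A' B : Wtwo F) : wmul (A - A') B = wmul A B - wmul A' B := by
  apply LinearMap.ext; intro x; apply LinearMap.ext; intro y
  simp [wmul]; abel

theorem wmul_sub_right (A B B' : Wtwo F) : wmul A (B - B') = wmul A B - wmul A B' := by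
  apply LinearMap.ext; intro x; apply LinearMap.ext; intro y
  simp [wmul]; abel

theorem wmul_alph (k i j k' i' j' : Fin 2) :
    wmul (alph k i j) (alph k' i' j' : Wtwo F) =
      (if i = 0 then (1:F) else 0) •
        ((if j = k' then (1:F) else 0) • alph k i' j'
          - (if k = i' then (1:F) else 0) • alph k' j j'
          - (if k = j' then (1:F) else 0) • alph k' i' j) := by
  apply LinearMap.ext; intro x; apply LinearMap.ext; intro y
  funext m
  simp [wmul, alph, v1, Pi.single_apply]
  split_ifs <;> simp_all <;> try ring

theorem mul_e4_left (B : Wtwo F) : wmul (e4 F) B = 0 := by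
  apply LinearMap.ext; intro x; apply LinearMap.ext; intro y
  simp [wmul, e4, alph, v1, Pi.single_apply]

theorem mul_e1_e1 : wmul (e1 F) (e1 F) = ((-1 : F)) • e1 F := by
  simp only [e1, e2, e3, e4, wmul_sub_left, wmul_sub_right, wmul_add_left, wmul_add_right,
    wmul_smul_left, wmul_smul_right, wmul_alph, Fin.reduceEq, reduceIte, one_smul, zero_smul,
    smul_zero, sub_zero, zero_sub, smul_sub, smul_add, smul_smul, neg_neg, smul_neg, neg_zero,
    sub_self, add_zero, zero_add]
  try module

theorem mul_e1_e2 : wmul (e1 F) (e2 F) = ((-3 : F)) • e2 F := by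
  simp only [e1, e2, e3, e4, wmul_sub_left, wmul_sub_right, wmul_add_left, wmul_add_right,
    wmul_smul_left, wmul_smul_right, wmul_alph, Fin.reduceEq, reduceIte, one_smul, zero_smul,
    smul_zero, sub_zero, zero_sub, smul_sub, smul_add, smul_smul, neg_neg, smul_neg, neg_zero,
    sub_self, add_zero, zero_add]
  try module

theorem mul_e1_e3 : wmul (e1 F) (e3 F) = ((1 : F)) • e3 F := by
  simp only [e1, e2, e3, e4, wmul_sub_left, wmul_sub_right, wmul_add_left, wmul_add_right,
    wmul_smul_left, wmul_smul_right, wmul_alph, Fin.reduceEq, reduceIte, one_smul, zero_smul,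
    smul_zero, sub_zero, zero_sub, smul_sub, smul_add, smul_smul, neg_neg, smul_neg, neg_zero,
    sub_self, add_zero, zero_add]
  try module

theorem mul_e1_e4 : wmul (e1 F) (e4 F) = ((3 : F)) • e4 F := by
  simp only [e1, e2, e3, e4, wmul_sub_left, wmul_sub_right, wmul_add_left, wmul_add_right,
    wmul_smul_left, wmul_smul_right, wmul_alph, Fin.reduceEq, reduceIte, one_smul, zero_smul,
    smul_zero, sub_zero, zero_sub, smul_sub, smul_add, smul_smul, neg_neg, smul_neg, neg_zero,
    sub_self, add_zero, zero_add]
  try module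

theorem mul_e2_e1 : wmul (e2 F) (e1 F) = ((3 : F)) • e2 F := by
  simp only [e1, e2, e3, e4, wmul_sub_left, wmul_sub_right, wmul_add_left, wmul_add_right,
    wmul_smul_left, wmul_smul_right, wmul_alph, Fin.reduceEq, reduceIte, one_smul, zero_smul,
    smul_zero, sub_zero, zero_sub, smul_sub, smul_add, smul_smul, neg_neg, smul_neg, neg_zero,
    sub_self, add_zero, zero_add]
  try module

theorem mul_e2_e2 : wmul (e2 F) (e2 F) = 0 := by
  simp only [e1, e2, e3, e4, wmul_sub_left, wmul_sub_right, wmul_add_left, wmul_add_right,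
    wmul_smul_left, wmul_smul_right, wmul_alph, Fin.reduceEq, reduceIte, one_smul, zero_smul,
    smul_zero, sub_zero, zero_sub, smul_sub, smul_add, smul_smul, neg_neg, smul_neg, neg_zero,
    sub_self, add_zero, zero_add]
  try module

theorem mul_e2_e3 : wmul (e2 F) (e3 F) = ((2 : F)) • e1 F := by
  simp only [e1, e2, e3, e4, wmul_sub_left, wmul_sub_right, wmul_add_left, wmul_add_right,
    wmul_smul_left, wmul_smul_right, wmul_alph, Fin.reduceEq, reduceIte, one_smul, zero_smul,
    smul_zero, sub_zero, zero_sub, smul_sub, smul_add, smul_smul, neg_neg, smul_neg, neg_zero,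
    sub_self, add_zero, zero_add]
  try module

theorem mul_e2_e4 : wmul (e2 F) (e4 F) = ((1 : F)) • e3 F := by
  simp only [e1, e2, e3, e4, wmul_sub_left, wmul_sub_right, wmul_add_left, wmul_add_right,
    wmul_smul_left, wmul_smul_right, wmul_alph, Fin.reduceEq, reduceIte, one_smul, zero_smul,
    smul_zero, sub_zero, zero_sub, smul_sub, smul_add, smul_smul, neg_neg, smul_neg, neg_zero,
    sub_self, add_zero, zero_add]
  try module

theorem mul_e3_e1 : wmul (e3 F) (e1 F) = ((-2 : F)) • e3 F := by
  simp only [e1, e2, e3, e4, wmul_sub_left, wmul_sub_right, wmul_add_left, wmul_add_right,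
    wmul_smul_left, wmul_smul_right, wmul_alph, Fin.reduceEq, reduceIte, one_smul, zero_smul,
    smul_zero, sub_zero, zero_sub, smul_sub, smul_add, smul_smul, neg_neg, smul_neg, neg_zero,
    sub_self, add_zero, zero_add]
  try module

theorem mul_e3_e2 : wmul (e3 F) (e2 F) = ((-1 : F)) • e1 F := by
  simp only [e1, e2, e3, e4, wmul_sub_left, wmul_sub_right, wmul_add_left, wmul_add_right,
    wmul_smul_left, wmul_smul_right, wmul_alph, Fin.reduceEq, reduceIte, one_smul, zero_smul,
    smul_zero, sub_zero, zero_sub, smul_sub, smul_add, smul_smul, neg_neg, smul_neg, neg_zero,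
    sub_self, add_zero, zero_add]
  try module

theorem mul_e3_e3 : wmul (e3 F) (e3 F) = ((-3 : F)) • e4 F := by
  simp only [e1, e2, e3, e4, wmul_sub_left, wmul_sub_right, wmul_add_left, wmul_add_right,
    wmul_smul_left, wmul_smul_right, wmul_alph, Fin.reduceEq, reduceIte, one_smul, zero_smul,
    smul_zero, sub_zero, zero_sub, smul_sub, smul_add, smul_smul, neg_neg, smul_neg, neg_zero,
    sub_self, add_zero, zero_add]
  try module

theorem mul_e3_e4 : wmul (e3 F) (e4 F) = 0 := by
  simp only [e1, e2, e3, e4, wmul_sub_left, wmul_sub_right, wmul_add_left, wmul_add_right,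
    wmul_smul_left, wmul_smul_right, wmul_alph, Fin.reduceEq, reduceIte, one_smul, zero_smul,
    smul_zero, sub_zero, zero_sub, smul_sub, smul_add, smul_smul, neg_neg, smul_neg, neg_zero,
    sub_self, add_zero, zero_add]
  try module

/-- `S2` as a subspace of `W(2)`. -/
noncomputable def S2 (F : Type*) [Field F] : Submodule F (Wtwo F) :=
  Submodule.span F {e1 F, e2 F, e3 F, e4 F}

/-- The Kantor product, as a bilinear map. -/
noncomputable def wmulL (F : Type*) [Field F] : Wtwo F →ₗ[F] Wtwo F →ₗ[F] Wtwo F :=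
  LinearMap.mk₂ F wmul wmul_add_left wmul_smul_left wmul_add_right wmul_smul_right

theorem S2_mul_mem {x y : Wtwo F} (hx : x ∈ S2 F) (hy : y ∈ S2 F) :
    wmul x y ∈ S2 F := by
  have h2 : Submodule.map₂ (wmulL F) (S2 F) (S2 F) ≤ S2 F := by
    rw [S2, Submodule.map₂_span_span, Submodule.span_le]
    rintro z ⟨a, ha, b, hb, rfl⟩
    simp only [Set.mem_insert_iff, Set.mem_singleton_iff] at ha hb
    rcases ha with rfl | rfl | rfl | rfl <;> rcases hb with rfl | rfl | rfl | rfl <;>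
      simp only [wmulL, LinearMap.mk₂_apply, mul_e1_e1, mul_e1_e2, mul_e1_e3, mul_e1_e4, mul_e2_e1, mul_e2_e2, mul_e2_e3, mul_e2_e4, mul_e3_e1, mul_e3_e2, mul_e3_e3, mul_e3_e4, mul_e4_left] <;>
      first
        | exact Submodule.zero_mem _
        | exact Submodule.smul_mem _ _ (Submodule.subset_span (by simp))
        | exact Submodule.subset_span (by simp)
  exact h2 (Submodule.apply_mem_map₂ _ hx hy)

/-- The product on `S2` (the Kantor product, which leaves `S2` invariant). -/
noncomputable def S2mul (x y : S2 F) : S2 F :=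
  ⟨wmul x y, S2_mul_mem x.2 y.2⟩

/-- A derivation of the algebra `S2`. -/
def IsDerivationS2 (D : S2 F →ₗ[F] S2 F) : Prop :=
  ∀ x y : S2 F, D (S2mul x y) = S2mul (D x) y + S2mul x (D y)

/-- The element `a e₁ + b e₂ + c e₃ + d e₄` of `S2`. -/
noncomputable def S2ofCoords (a b c d : F) : S2 F :=
  ⟨a • e1 F + b • e2 F + c • e3 F + d • e4 F, by
    have h : ∀ x ∈ ({e1 F, e2 F, e3 F, e4 F} : Set (Wtwo F)), ∀ r : F, r • x ∈ S2 F :=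
      fun x hx r => Submodule.smul_mem _ r (Submodule.subset_span hx)
    exact add_mem (add_mem (add_mem (h _ (by simp) a) (h _ (by simp) b)) (h _ (by simp) c))
      (h _ (by simp) d)⟩

theorem exists_eq_S2ofCoords (x : S2 F) : ∃ a b c d : F, x = S2ofCoords a b c d := by
  obtain ⟨x, hx⟩ := x
  simp only [S2, Submodule.mem_span_insert, Submodule.mem_span_singleton] at hx
  obtain ⟨a, _, ⟨b, _, ⟨c, _, ⟨d, rfl⟩, rfl⟩, rfl⟩, rfl⟩ := hx
  refine ⟨a, b, c, d, Subtype.ext ?_⟩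
  simp only [S2ofCoords]
  abel

theorem S2ofCoords_inj {a b c d a' b' c' d' : F} :
    S2ofCoords a b c d = S2ofCoords a' b' c' d' ↔ a = a' ∧ b = b' ∧ c = c' ∧ d = d' := by
  refine ⟨fun h => ?_, by rintro ⟨rfl, rfl, rfl, rfl⟩; rfl⟩
  have key (i k : Fin 2) := congrArg
    (fun z : S2 F => (z : Wtwo F) (Pi.single i 1) (Pi.single i 1) k) h
  have h00 := key 0 0
  have h01 := key 0 1
  have h11 := key 1 1
  have h10 := key 1 0
  simp [S2ofCoords, e1, e2, e3, e4, alph] at h00 h01 h11 h10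
  exact ⟨h00, h01, h11, h10⟩

theorem S2ofCoords_add (a b c d a' b' c' d' : F) :
    S2ofCoords a b c d + S2ofCoords a' b' c' d' =
      S2ofCoords (a + a') (b + b') (c + c') (d + d') := by
  apply Subtype.ext
  simp only [S2ofCoords, Submodule.coe_add]
  module

theorem smul_S2ofCoords (r a b c d : F) :
    r • S2ofCoords a b c d = S2ofCoords (r * a) (r * b) (r * c) (r * d) := by
  apply Subtype.ext
  simp only [S2ofCoords, Submodule.coe_smul]
  module

theorem S2mul_S2ofCoords (a b c d a' b' c' d' : F) :
    S2mul (S2ofCoords a b c d) (S2ofCoords a' b' c' d') =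
      S2ofCoords (-a * a' + 2 * b * c' - c * b') (-3 * a * b' + 3 * b * a')
        (a * c' + b * d' - 2 * c * a') (3 * a * d' - 3 * c * c') := by
  apply Subtype.ext
  simp only [S2mul, S2ofCoords, wmul_add_left, wmul_add_right, wmul_smul_left, wmul_smul_right,
    mul_e1_e1, mul_e1_e2, mul_e1_e3, mul_e1_e4, mul_e2_e1, mul_e2_e2, mul_e2_e3, mul_e2_e4,
    mul_e3_e1, mul_e3_e2, mul_e3_e3, mul_e3_e4, mul_e4_left]
  module

theorem map_S2ofCoords (D : S2 F →ₗ[F] S2 F) (a b c d : F) :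
    D (S2ofCoords a b c d) = a • D (S2ofCoords 1 0 0 0) + b • D (S2ofCoords 0 1 0 0) +
      c • D (S2ofCoords 0 0 1 0) + d • D (S2ofCoords 0 0 0 1) := by
  simp only [← map_smul, ← map_add, smul_S2ofCoords, S2ofCoords_add]
  simp

/-- Derivations of `S2` form a two-parameter family, given here in coordinates. -/
theorem IsDerivationS2.exists_coords [CharZero F] {D : S2 F →ₗ[F] S2 F} (hD : IsDerivationS2 D) :
    ∃ s t : F, ∀ a b c d : F, D (S2ofCoords a b c d) =
      S2ofCoords (t * b) (-s * b) (2 * t * a + s * c) (3 * t * c + 2 * s * d) := by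
  obtain ⟨a1, b1, c1, d1, h1⟩ := exists_eq_S2ofCoords (D (S2ofCoords 1 0 0 0))
  obtain ⟨a2, b2, c2, d2, h2⟩ := exists_eq_S2ofCoords (D (S2ofCoords 0 1 0 0))
  obtain ⟨a3, b3, c3, d3, h3⟩ := exists_eq_S2ofCoords (D (S2ofCoords 0 0 1 0))
  obtain ⟨a4, b4, c4, d4, h4⟩ := exists_eq_S2ofCoords (D (S2ofCoords 0 0 0 1))
  have hmap (a b c d : F) := map_S2ofCoords D a b c d
  simp only [h1, h2, h3, h4, smul_S2ofCoords, S2ofCoords_add] at hmap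
  have hmul (a b c d a' b' c' d' : F) := hD (S2ofCoords a b c d) (S2ofCoords a' b' c' d')
  simp only [S2mul_S2ofCoords, hmap, S2ofCoords_add, S2ofCoords_inj] at hmul
  have h11 := hmul 1 0 0 0 1 0 0 0
  have h21 := hmul 0 1 0 0 1 0 0 0
  have h22 := hmul 0 1 0 0 0 1 0 0
  have h13 := hmul 1 0 0 0 0 0 1 0
  have h33 := hmul 0 0 1 0 0 0 1 0
  have h23 := hmul 0 1 0 0 0 0 1 0
  have h24 := hmul 0 1 0 0 0 0 0 1
  clear hmul h1 h2 h3 h4 hD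
  simp only [mul_zero, zero_mul, mul_one, one_mul, add_zero, zero_add, sub_zero, zero_sub]
    at h11 h21 h22 h13 h33 h23 h24
  refine ⟨-b2, a2, fun a b c d => ?_⟩
  have hcoords : a1 = 0 ∧ b1 = 0 ∧ c1 = 2 * a2 ∧ d1 = 0 ∧ c2 = 0 ∧ d2 = 0 ∧ a3 = 0 ∧ b3 = 0 ∧
      c3 = -b2 ∧ d3 = 3 * a2 ∧ a4 = 0 ∧ b4 = 0 ∧ c4 = 0 ∧ d4 = -2 * b2 := by
    grind
  obtain ⟨rfl, rfl, rfl, rfl, rfl, rfl, rfl, rfl, rfl, rfl, rfl, rfl, rfl, rfl⟩ := hcoords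
  rw [hmap, S2ofCoords_inj]
  refine ⟨?_, ?_, ?_, ?_⟩ <;> ring

/-- Every local derivation of the algebra `S2` is a derivation. -/
theorem every_localDerivation_isDerivation_S2 {F : Type*} [Field F] [CharZero F]
    (T : S2 F →ₗ[F] S2 F)
    (hT : ∀ x : S2 F, ∃ D : S2 F →ₗ[F] S2 F, IsDerivationS2 D ∧ T x = D x) :
    IsDerivationS2 T := by
  obtain ⟨D, hD, hTD⟩ := hT (S2ofCoords 0 1 0 0)
  obtain ⟨s, t, hst⟩ := hD.exists_coords
  have agree (a c d : F) : T (S2ofCoords a 0 c d) = D (S2ofCoords a 0 c d) := by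
    obtain ⟨D', hD', h'⟩ := hT (S2ofCoords a 1 c d)
    obtain ⟨D'', hD'', h''⟩ := hT (S2ofCoords a 0 c d)
    obtain ⟨s', t', hst'⟩ := hD'.exists_coords
    obtain ⟨s'', t'', hst''⟩ := hD''.exists_coords
    have hsum : S2ofCoords a 1 c d = S2ofCoords 0 1 0 0 + S2ofCoords a 0 c d := by
      simp [S2ofCoords_add]
    rw [hst'] at h'
    rw [hsum, map_add, hTD, h'', hst, hst'', S2ofCoords_add, S2ofCoords_inj] at h'
    rw [h'', hst, hst'', S2ofCoords_inj]
    grind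
  have hTeq : T = D := by
    ext1 x
    obtain ⟨a, b, c, d, rfl⟩ := exists_eq_S2ofCoords x
    rw [map_S2ofCoords T, map_S2ofCoords D, agree, agree, agree, hTD]
  rwa [hTeq]
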